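/- arXiv:2006.13928 — 2 statements merged into one kernel-verified Lean document; each statement's English description precedes it below -/
import Mathlib

section
/- Let k₁, k₂, s ∈ ℝ, and set K = k₁k₂ and H = (k₁ + k₂)/2. If cos²s − sin(2s)·H + sin²s·K ≠ 0, then cos s − k₁ sin s ≠ 0, cos s − k₂ sin s ≠ 0, and ((sin s + k₁ cos s)/(cos s − k₁ sin s)) · ((sin s + k₂ cos s)/(cos s − k₂ sin s)) = (sin²s + sin(2s)·H + cos²s·K)/(cos²s − sin(2s)·H + sin²s·K). (This expresses the extrinsic curvature K^s_{ext} = k₁^s k₂^s of the parallel surface at distance s of a surface in S³ in terms of the extrinsic curvature K and mean curvature H of the original surface.) -/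
/-- the extrinsic curvature `K^s_{ext} = k₁^s k₂^s` of the parallel surface at
distance `s` of a surface in `S³` in terms of the extrinsic curvature `K` and mean
curvature `H` of the original surface. -/
theorem stmt5 (k₁ k₂ s K H : ℝ) (hK : K = k₁ * k₂) (hH : H = (k₁ + k₂) / 2)
    (h : Real.cos s ^ 2 - Real.sin (2 * s) * H + Real.sin s ^ 2 * K ≠ 0) :
    Real.cos s - k₁ * Real.sin s ≠ 0 ∧
    Real.cos s - k₂ * Real.sin s ≠ 0 ∧
    ((Real.sin s + k₁ * Real.cos s) / (Real.cos s - k₁ * Real.sin s)) *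
        ((Real.sin s + k₂ * Real.cos s) / (Real.cos s - k₂ * Real.sin s)) =
      (Real.sin s ^ 2 + Real.sin (2 * s) * H + Real.cos s ^ 2 * K) /
        (Real.cos s ^ 2 - Real.sin (2 * s) * H + Real.sin s ^ 2 * K) := by
  have hden : Real.cos s ^ 2 - Real.sin (2 * s) * H + Real.sin s ^ 2 * K =
      (Real.cos s - k₁ * Real.sin s) * (Real.cos s - k₂ * Real.sin s) := by
    rw [hK, hH, Real.sin_two_mul]
    ring
  have hnum : Real.sin s ^ 2 + Real.sin (2 * s) * H + Real.cos s ^ 2 * K =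
      (Real.sin s + k₁ * Real.cos s) * (Real.sin s + k₂ * Real.cos s) := by
    rw [hK, hH, Real.sin_two_mul]
    ring
  rw [hden] at h
  exact ⟨left_ne_zero_of_mul h, right_ne_zero_of_mul h, by rw [hden, hnum, div_mul_div_comm]⟩
end

section
/- Let ε, λ ∈ ℝ, let I ⊆ ℝ be a nonempty open interval, and let B : ℝ → ℝ be twice differentiable on I satisfying ε + 2(B'(s))² − ε e^{2B(s)} − B''(s) − (λ e^{2B(s)} − ε) = 0 for all s ∈ I. Then the function y(s) = e^{−2B(s)} satisfies the linear equation y''(s) + 4ε y(s) = 2(ε + λ) for all s ∈ I. -/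
/-- if `B` is twice differentiable on a nonempty open interval `I` and
satisfies `ε + 2(B')² − ε e^{2B} − B'' − (λ e^{2B} − ε) = 0` on `I`, then
`y = e^{−2B}` satisfies the linear equation `y'' + 4ε y = 2(ε + λ)` on `I`. -/
theorem stmt8 (ε lam : ℝ) (a b : ℝ) (hab : a < b) (B B' B'' : ℝ → ℝ)
    (hB : ∀ s ∈ Set.Ioo a b, HasDerivAt B (B' s) s)
    (hB' : ∀ s ∈ Set.Ioo a b, HasDerivAt B' (B'' s) s)
    (hode : ∀ s ∈ Set.Ioo a b,
      ε + 2 * (B' s) ^ 2 - ε * Real.exp (2 * B s) - B'' s - (lam * Real.exp (2 * B s) - ε) = 0) :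
    ∃ y' y'' : ℝ → ℝ,
      (∀ s ∈ Set.Ioo a b, HasDerivAt (fun u => Real.exp (-2 * B u)) (y' s) s) ∧
      (∀ s ∈ Set.Ioo a b, HasDerivAt y' (y'' s) s) ∧
      (∀ s ∈ Set.Ioo a b, y'' s + 4 * ε * Real.exp (-2 * B s) = 2 * (ε + lam)) := by
  have hy : ∀ s ∈ Set.Ioo a b, HasDerivAt (fun u => Real.exp (-2 * B u))
      (Real.exp (-2 * B s) * (-2 * B' s)) s := fun s hs => ((hB s hs).const_mul (-2)).exp
  refine ⟨_, fun s => Real.exp (-2 * B s) * (-2 * B' s) * (-2 * B' s)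
    + Real.exp (-2 * B s) * (-2 * B'' s), hy,
    fun s hs => (hy s hs).mul ((hB' s hs).const_mul (-2)), fun s hs => ?_⟩
  have hexp : Real.exp (-2 * B s) * Real.exp (2 * B s) = 1 := by
    rw [← Real.exp_add]
    simp
  linear_combination 2 * Real.exp (-2 * B s) * hode s hs + 2 * (ε + lam) * hexp
end
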